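/- (Compatibility condition (S₁), Theorem 2.2.) For every integer n ≥ 0 and every z ∈ ℂ with Im z ≠ 0: B_{n+1}(z) + B_n(z) = (z − α_n)·A_n(z) − 2z. -/

import Mathlib

open MeasureTheory Polynomial

/-! ### Monic orthogonal polynomials for a linear functional -/

section OrthogonalPolynomials

variable {L : ℝ[X] →ₗ[ℝ] ℝ} {P : ℕ → ℝ[X]} {h : ℕ → ℝ}

/-- Pairing with `P n` a polynomial of degree at most `n` reads off its `n`-th coefficient. -/
theorem functional_mul_eq_coeff_mul (hmonic : ∀ n, (P n).Monic) (hdeg : ∀ n, (P n).natDegree = n)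
    (horth : ∀ m n, m ≠ n → L (P m * P n) = 0) (hnorm : ∀ n, L (P n * P n) = h n) (n : ℕ)
    (p : ℝ[X]) (hp : p.degree < (n + 1 : ℕ)) : L (P n * p) = p.coeff n * h n := by
  have key : ∀ k, ∀ q : ℝ[X], k ≤ n + 1 → q.degree < (k : ℕ) → L (P n * q) = q.coeff n * h n := by
    intro k
    induction k with
    | zero =>
      intro q _ hq
      have : q = 0 := by
        rw [← degree_eq_bot]
        simpa using (Nat.WithBot.lt_zero_iff).1 hq
      simp [this]
    | succ k ih =>
      intro q hk hq
      have hPk : (C (q.coeff k) * P k).coeff k = q.coeff k := by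
        have := (hmonic k).coeff_natDegree
        rw [hdeg k] at this
        simp [this]
      have hr : (q - C (q.coeff k) * P k).degree < (k : ℕ) := by
        rw [degree_lt_iff_coeff_zero]
        intro m hm
        rcases hm.eq_or_lt with rfl | hm
        · simp only [coeff_sub, hPk, sub_self]
        · have h1 : q.coeff m = 0 := (degree_lt_iff_coeff_zero _ _).1 hq m hm
          have h2 : (P k).coeff m = 0 := coeff_eq_zero_of_natDegree_lt (by rw [hdeg k]; exact hm)
          simp [h1, h2]
      have h1 := ih _ (by omega) hr
      have h2 : L (P n * q) = L (P n * (q - C (q.coeff k) * P k)) + q.coeff k * L (P n * P k) := by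
        rw [← smul_eq_mul (q.coeff k), ← map_smul, ← map_add]
        congr 1
        rw [smul_eq_C_mul]
        ring
      rw [h2, h1, coeff_sub]
      rcases eq_or_ne k n with rfl | hkn
      · rw [hPk, hnorm]
        ring
      · rw [horth n k hkn.symm, coeff_C_mul, coeff_eq_zero_of_natDegree_lt (p := P k)
          (by rw [hdeg k]; omega)]
        ring
  exact key _ p le_rfl hp

theorem eq_zero_of_functional_mul_eq_zero (hmonic : ∀ n, (P n).Monic)
    (hdeg : ∀ n, (P n).natDegree = n) (horth : ∀ m n, m ≠ n → L (P m * P n) = 0)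
    (hnorm : ∀ n, L (P n * P n) = h n) (hh : ∀ n, h n ≠ 0) (n : ℕ)
    (q : ℝ[X]) (hq : q.natDegree ≤ n) (hzero : ∀ k ≤ n, L (P k * q) = 0) : q = 0 := by
  have h1 := functional_mul_eq_coeff_mul hmonic hdeg horth hnorm q.natDegree q
    (degree_le_natDegree.trans_lt (by exact_mod_cast Nat.lt_succ_self _))
  rw [hzero _ hq] at h1
  simpa [hh] using h1.symm

theorem coeff_X_mul_self_succ (hmonic : ∀ n, (P n).Monic) (hdeg : ∀ n, (P n).natDegree = n)
    (n : ℕ) : (X * P n).coeff (n + 1) = 1 := by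
  have := (hmonic n).coeff_natDegree
  rw [hdeg n] at this
  simpa using this

theorem natDegree_recurrence_le (hmonic : ∀ n, (P n).Monic) (hdeg : ∀ n, (P n).natDegree = n)
    (n : ℕ) (a : ℝ) : (P (n + 1) - (X - C a) * P n).natDegree ≤ n := by
  rw [natDegree_le_iff_coeff_eq_zero]
  intro m hm
  have h2 : (P n).coeff m = 0 := coeff_eq_zero_of_natDegree_lt (by rw [hdeg n]; exact hm)
  have h0 : ((X - C a) * P n).coeff m = (X * P n).coeff m := by
    simp [sub_mul, h2]
  rw [coeff_sub, h0]
  rcases (Nat.succ_le_of_lt hm).eq_or_lt with rfl | hm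
  · have := (hmonic (n + 1)).coeff_natDegree
    rw [hdeg] at this
    rw [Nat.succ_eq_add_one, this, coeff_X_mul_self_succ hmonic hdeg, sub_self]
  · rw [coeff_eq_zero_of_natDegree_lt (by rw [hdeg]; exact hm), coeff_eq_zero_of_natDegree_lt,
      sub_zero]
    rw [natDegree_X_mul (hmonic n).ne_zero, hdeg]
    exact hm

theorem functional_mul_recurrence (a : ℝ) (k n : ℕ) :
    L (P k * (P (n + 1) - (X - C a) * P n)) =
      L (P k * P (n + 1)) - L (P n * (X * P k)) + a * L (P k * P n) := by
  rw [← smul_eq_mul a, ← map_smul, ← map_sub, ← map_add, smul_eq_C_mul]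
  congr 1
  ring

/-- The first step of the three-term recurrence. -/
theorem recurrence_zero (hmonic : ∀ n, (P n).Monic) (hdeg : ∀ n, (P n).natDegree = n)
    (horth : ∀ m n, m ≠ n → L (P m * P n) = 0) (hnorm : ∀ n, L (P n * P n) = h n)
    (hh : ∀ n, h n ≠ 0) (a : ℝ) (ha : L (P 0 * (X * P 0)) = a * h 0) :
    P 1 = (X - C a) * P 0 := by
  rw [← sub_eq_zero]
  refine eq_zero_of_functional_mul_eq_zero hmonic hdeg horth hnorm hh 0 _
    (natDegree_recurrence_le hmonic hdeg 0 a) fun k hk => ?_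
  obtain rfl : k = 0 := by omega
  rw [functional_mul_recurrence, horth _ _ (by omega), hnorm, ha]
  ring

/-- The three-term recurrence. -/
theorem recurrence_succ (hmonic : ∀ n, (P n).Monic) (hdeg : ∀ n, (P n).natDegree = n)
    (horth : ∀ m n, m ≠ n → L (P m * P n) = 0) (hnorm : ∀ n, L (P n * P n) = h n)
    (hh : ∀ n, h n ≠ 0) (n : ℕ) (a : ℝ)
    (ha : L (P (n + 1) * (X * P (n + 1))) = a * h (n + 1)) :
    P (n + 2) = (X - C a) * P (n + 1) - C (h (n + 1) / h n) * P n := by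
  rw [← sub_eq_zero]
  have hsplit : P (n + 2) - ((X - C a) * P (n + 1) - C (h (n + 1) / h n) * P n) =
      (P (n + 1 + 1) - (X - C a) * P (n + 1)) + (h (n + 1) / h n) • P n := by
    rw [smul_eq_C_mul]
    ring
  rw [hsplit]
  refine eq_zero_of_functional_mul_eq_zero hmonic hdeg horth hnorm hh (n + 1) _
    (natDegree_add_le_of_degree_le (natDegree_recurrence_le hmonic hdeg (n + 1) a)
      ((natDegree_smul_le _ _).trans (by rw [hdeg]; omega))) fun k hk => ?_
  rw [mul_add, map_add, functional_mul_recurrence, horth k _ (by omega), mul_smul_comm, map_smul,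
    smul_eq_mul]
  rcases hk.eq_or_lt with rfl | hk
  · rw [ha, hnorm, horth (n + 1) n (by omega)]
    ring
  have hX := functional_mul_eq_coeff_mul hmonic hdeg horth hnorm (n + 1) (X * P k) (by
    refine degree_le_natDegree.trans_lt ?_
    rw [natDegree_X_mul (hmonic k).ne_zero, hdeg]
    exact_mod_cast (by omega : k + 1 < n + 1 + 1))
  rw [hX, horth k (n + 1) (by omega)]
  rcases (Nat.lt_succ_iff.1 hk).eq_or_lt with rfl | hk
  · rw [coeff_X_mul_self_succ hmonic hdeg, hnorm]
    field_simp [hh k]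
    ring
  · rw [horth k n (by omega), coeff_X_mul, coeff_eq_zero_of_natDegree_lt (by rw [hdeg]; exact hk)]
    ring

end OrthogonalPolynomials

/-! ### The Gaussian weight with algebraic singularities -/

/-- The weight `exp (-x²) ∏ⱼ |x - tⱼ| ^ γⱼ`. -/
noncomputable def singularGaussian {ι : Type*} [Fintype ι] (t γ : ι → ℝ) (x : ℝ) : ℝ :=
  Real.exp (-x ^ 2) * ∏ j, |x - t j| ^ γ j

theorem integrable_eval_mul_exp_neg_sq (p : ℝ[X]) :
    Integrable fun x : ℝ => p.eval x * Real.exp (-x ^ 2) := by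
  induction p using Polynomial.induction_on' with
  | add p q hp hq =>
    simp only [eval_add, add_mul]
    exact hp.add hq
  | monomial n a =>
    have h := (integrable_rpow_mul_exp_neg_mul_sq (b := 1) one_pos (s := n)
      (by linarith [n.cast_nonneg (α := ℝ)])).const_mul a
    simpa [mul_assoc] using h

theorem tendsto_eval_mul_exp_neg_sq (p : ℝ[X]) :
    Filter.Tendsto (fun x : ℝ => p.eval x * Real.exp (-x ^ 2)) (Filter.cocompact ℝ) (nhds 0) := by
  induction p using Polynomial.induction_on' with
  | add p q hp hq =>
    simpa only [eval_add, add_mul, add_zero] using hp.add hq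
  | monomial n a =>
    have h := (tendsto_rpow_abs_mul_exp_neg_mul_sq_cocompact one_pos n).const_mul |a|
    rw [mul_zero] at h
    refine squeeze_zero_norm (fun x => le_of_eq ?_) h
    simp [mul_assoc]

theorem intervalIntegrable_abs_sub_rpow {s : ℝ} (hs : -1 < s) (c a b : ℝ) :
    IntervalIntegrable (fun x : ℝ => |x - c| ^ s) volume a b := by
  have h := (intervalIntegral.intervalIntegrable_cpow' (a := a - c) (b := b - c) (r := (s : ℂ))
    (by simpa using hs)).norm.comp_sub_right c
  simpa only [sub_add_cancel, Complex.norm_cpow_real, Complex.norm_real, Real.norm_eq_abs] using h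

theorem abs_rpow_le_one_add_pow (x : ℝ) {g : ℝ} (hg : 0 ≤ g) :
    |x| ^ g ≤ 1 + x ^ (2 * ⌈g⌉₊) := by
  have hpow : x ^ (2 * ⌈g⌉₊) = |x| ^ (2 * ⌈g⌉₊) := by
    rw [pow_mul, pow_mul, sq_abs]
  rw [hpow]
  rcases le_total |x| 1 with h | h
  · exact (Real.rpow_le_one (abs_nonneg x) h hg).trans (by simp)
  · calc |x| ^ g ≤ |x| ^ ((2 * ⌈g⌉₊ : ℕ) : ℝ) := by
          refine Real.rpow_le_rpow_of_exponent_le h ?_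
          push_cast
          linarith [Nat.le_ceil g]
      _ = |x| ^ (2 * ⌈g⌉₊) := Real.rpow_natCast _ _
      _ ≤ _ := by linarith

section Weight

variable {ι : Type*} [Fintype ι] {t γ : ι → ℝ}

theorem continuous_singularGaussian (hγ : ∀ j, 0 < γ j) : Continuous (singularGaussian t γ) := by
  unfold singularGaussian
  refine Continuous.mul (by fun_prop) (continuous_finsetProd _ fun j _ => ?_)
  exact Continuous.rpow_const (by fun_prop) fun _ => Or.inr (hγ j).le

theorem singularGaussian_nonneg (x : ℝ) : 0 ≤ singularGaussian t γ x := by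
  unfold singularGaussian
  positivity

theorem exists_singularGaussian_le (t : ι → ℝ) (hγ : ∀ j, 0 < γ j) :
    ∃ q : ℝ[X], ∀ x, singularGaussian t γ x ≤ q.eval x * Real.exp (-x ^ 2) := by
  refine ⟨∏ j, (1 + (X - C (t j)) ^ (2 * ⌈γ j⌉₊)), fun x => ?_⟩
  rw [singularGaussian, mul_comm, eval_prod]
  gcongr with j
  simpa using abs_rpow_le_one_add_pow (x - t j) (hγ j).le

theorem abs_eval_le_eval_one_add_sq (p : ℝ[X]) (x : ℝ) :
    |p.eval x| ≤ (1 + p ^ 2).eval x := by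
  simp only [eval_add, eval_one, eval_pow]
  rw [abs_le]
  constructor <;> nlinarith [sq_nonneg (p.eval x - 1), sq_nonneg (p.eval x + 1)]

theorem exists_abs_eval_mul_singularGaussian_le (t : ι → ℝ) (hγ : ∀ j, 0 < γ j) (p : ℝ[X]) :
    ∃ q : ℝ[X], ∀ x, |p.eval x * singularGaussian t γ x| ≤ q.eval x * Real.exp (-x ^ 2) := by
  obtain ⟨q, hq⟩ := exists_singularGaussian_le t hγ
  refine ⟨(1 + p ^ 2) * q, fun x => ?_⟩
  rw [abs_mul, abs_of_nonneg (singularGaussian_nonneg x), eval_mul, mul_assoc]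
  exact mul_le_mul (abs_eval_le_eval_one_add_sq p x) (hq x) (singularGaussian_nonneg x)
    ((abs_nonneg _).trans (abs_eval_le_eval_one_add_sq p x))

theorem integrable_eval_mul_singularGaussian (hγ : ∀ j, 0 < γ j) (p : ℝ[X]) :
    Integrable fun x => p.eval x * singularGaussian t γ x := by
  obtain ⟨q, hq⟩ := exists_abs_eval_mul_singularGaussian_le t hγ p
  exact (integrable_eval_mul_exp_neg_sq q).mono'
    (p.continuous.mul (continuous_singularGaussian hγ)).aestronglyMeasurable (.of_forall hq)

theorem tendsto_eval_mul_singularGaussian (hγ : ∀ j, 0 < γ j) (p : ℝ[X]) :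
    Filter.Tendsto (fun x => p.eval x * singularGaussian t γ x) (Filter.cocompact ℝ) (nhds 0) := by
  obtain ⟨q, hq⟩ := exists_abs_eval_mul_singularGaussian_le t hγ p
  exact squeeze_zero_norm hq (tendsto_eval_mul_exp_neg_sq q)

theorem integrable_eval_mul_singularGaussian_div (hγ : ∀ j, 0 < γ j) (p : ℝ[X]) (j : ι) :
    Integrable fun x => p.eval x * singularGaussian t γ x / (x - t j) := by
  classical
  set s : Set ℝ := Set.Ioc (t j - 1) (t j + 1)
  have hcont := p.continuous.mul (continuous_singularGaussian (t := t) hγ)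
  have hmeas : AEStronglyMeasurable (fun x => p.eval x * singularGaussian t γ x / (x - t j)) :=
    (hcont.measurable.div (by fun_prop)).aestronglyMeasurable
  rw [← integrableOn_univ, ← Set.union_compl_self s]
  refine IntegrableOn.union ?_ ?_
  · have hloc : IntegrableOn (fun x => |x - t j| ^ (γ j - 1)) s :=
      (intervalIntegrable_iff_integrableOn_Ioc_of_le (by linarith)).1
        (intervalIntegrable_abs_sub_rpow (by linarith [hγ j]) (t j) _ _)
    set g : ℝ → ℝ := fun x => p.eval x * (Real.exp (-x ^ 2) *
      ∏ i ∈ Finset.univ.erase j, |x - t i| ^ γ i)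
    have hg : Continuous g := by
      refine p.continuous.mul (Continuous.mul (by fun_prop) (continuous_finsetProd _ fun i _ => ?_))
      exact Continuous.rpow_const (by fun_prop) fun _ => Or.inr (hγ i).le
    obtain ⟨C, hC⟩ := (isCompact_Icc (a := t j - 1) (b := t j + 1)).exists_bound_of_continuousOn
      hg.continuousOn
    have hprod : IntegrableOn (fun x => g x * |x - t j| ^ (γ j - 1)) s := by
      refine hloc.bdd_mul hg.aestronglyMeasurable (c := C) ?_
      exact (ae_restrict_iff' measurableSet_Ioc).2
        (.of_forall fun x hx => hC x (Set.Ioc_subset_Icc_self hx))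
    refine Integrable.mono hprod hmeas.restrict ?_
    filter_upwards [ae_restrict_of_ae (Measure.ae_ne volume (t j))] with x hx
    have hx' : 0 < |x - t j| := abs_pos.2 (sub_ne_zero.2 hx)
    have hw : singularGaussian t γ x = Real.exp (-x ^ 2) *
        (∏ i ∈ Finset.univ.erase j, |x - t i| ^ γ i) * |x - t j| ^ γ j := by
      rw [singularGaussian, mul_assoc, Finset.prod_erase_mul _ _ (Finset.mem_univ j)]
    refine le_of_eq ?_
    rw [hw, Real.rpow_sub_one hx'.ne']
    simp only [g, norm_div, norm_mul, Real.norm_eq_abs, abs_abs]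
    ring
  · refine Integrable.mono (integrable_eval_mul_singularGaussian (t := t) hγ p).integrableOn
      hmeas.restrict ?_
    refine (ae_restrict_iff' measurableSet_Ioc.compl).2 (.of_forall fun x hx => ?_)
    have hx1 : 1 ≤ |x - t j| := by
      by_contra! hlt
      rw [abs_lt] at hlt
      exact hx ⟨by linarith, by linarith⟩
    rw [norm_div]
    exact div_le_self (norm_nonneg _) hx1

theorem hasDerivAt_singularGaussian {x : ℝ} (hx : ∀ j, x ≠ t j) :
    HasDerivAt (singularGaussian t γ)
      ((-2 * x + ∑ j, γ j / (x - t j)) * singularGaussian t γ x) x := by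
  classical
  have hf : ∀ j ∈ Finset.univ, HasDerivAt (fun y => |y - t j| ^ γ j)
      (|x - t j| ^ γ j * (γ j / (x - t j))) x := by
    intro j _
    have hne : x - t j ≠ 0 := sub_ne_zero.2 (hx j)
    have h1 := (hasDerivAt_abs hne).comp_sub_const x (t j)
    have h2 := h1.rpow_const (p := γ j) (Or.inl (abs_pos.2 hne).ne')
    convert h2 using 1
    rw [Real.rpow_sub_one (abs_pos.2 hne).ne']
    have hsign : (SignType.sign (x - t j) : ℝ) / |x - t j| = 1 / (x - t j) := by
      rw [div_eq_div_iff (abs_pos.2 hne).ne' hne, sign_mul_self, one_mul]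
    linear_combination -(|x - t j| ^ γ j * γ j) * hsign
  have hprod := HasDerivAt.fun_finsetProd hf
  have hexp : HasDerivAt (fun y : ℝ => Real.exp (-y ^ 2)) (Real.exp (-x ^ 2) * (-(2 * x))) x := by
    simpa using ((hasDerivAt_pow 2 x).neg).exp
  have hsum : ∑ i, (∏ j ∈ Finset.univ.erase i, |x - t j| ^ γ j) •
      (|x - t i| ^ γ i * (γ i / (x - t i))) =
      (∏ j, |x - t j| ^ γ j) * ∑ i, γ i / (x - t i) := by
    rw [Finset.mul_sum]
    refine Finset.sum_congr rfl fun i hi => ?_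
    rw [smul_eq_mul, ← mul_assoc, Finset.prod_erase_mul _ _ hi]
  rw [hsum] at hprod
  refine (hexp.mul hprod).congr_deriv ?_
  rw [singularGaussian]
  ring

/-- Integration by parts against the weight. -/
theorem integral_eval_mul_logDeriv_singularGaussian (hγ : ∀ j, 0 < γ j) (p : ℝ[X]) :
    ∑ j, γ j * ∫ x, p.eval x * singularGaussian t γ x / (x - t j) =
      2 * (∫ x, (X * p).eval x * singularGaussian t γ x) -
        ∫ x, (derivative p).eval x * singularGaussian t γ x := by
  set F : ℝ → ℝ := fun x => p.eval x * singularGaussian t γ x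
  set f : ℝ → ℝ := fun x => ∑ j, γ j * (p.eval x * singularGaussian t γ x / (x - t j)) -
    (2 * ((X * p).eval x * singularGaussian t γ x) -
      (derivative p).eval x * singularGaussian t γ x)
  have hI1 : ∀ j ∈ Finset.univ,
      Integrable fun x => γ j * (p.eval x * singularGaussian t γ x / (x - t j)) :=
    fun j _ => (integrable_eval_mul_singularGaussian_div hγ p j).const_mul _
  have hI2 := (integrable_eval_mul_singularGaussian (t := t) hγ (X * p)).const_mul 2
  have hI3 := integrable_eval_mul_singularGaussian (t := t) hγ (derivative p)
  have hf : Integrable f := (integrable_finsetSum _ hI1).sub (hI2.sub hI3)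
  have hderiv : ∀ x, x ∉ Set.range t → HasDerivAt F (f x) x := by
    intro x hx
    refine ((p.hasDerivAt x).mul
      (hasDerivAt_singularGaussian (γ := γ) fun j hj => hx ⟨j, hj.symm⟩)).congr_deriv ?_
    have hs : ∑ j, γ j * (p.eval x * singularGaussian t γ x / (x - t j)) =
        p.eval x * singularGaussian t γ x * ∑ j, γ j / (x - t j) := by
      rw [Finset.mul_sum]
      exact Finset.sum_congr rfl fun j _ => by ring
    simp only [f, hs, eval_mul, eval_X]
    ring
  have hFTC : ∀ a b : ℝ, ∫ x in a..b, f x = F b - F a := fun a b =>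
    integral_eq_of_hasDerivAt_off_countable F f
      (Set.finite_range t).countable (p.continuous.mul (continuous_singularGaussian hγ)).continuousOn
      (fun x hx => hderiv x hx.2) hf.intervalIntegrable
  have hlim := intervalIntegral_tendsto_integral hf Filter.tendsto_neg_atTop_atBot
    (Filter.tendsto_id (α := ℝ) (x := Filter.atTop))
  have hF := tendsto_eval_mul_singularGaussian (t := t) hγ p
  rw [cocompact_eq_atBot_atTop, Filter.tendsto_sup] at hF
  have hlim' := hF.2.sub (hF.1.comp Filter.tendsto_neg_atTop_atBot)
  have hzero : ∫ x, f x = 0 := by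
    refine tendsto_nhds_unique hlim ?_
    simp only [hFTC]
    rwa [sub_zero] at hlim'
  have hsplit : ∫ x, f x = ∑ j, γ j * (∫ x, p.eval x * singularGaussian t γ x / (x - t j)) -
      (2 * (∫ x, (X * p).eval x * singularGaussian t γ x) -
        ∫ x, (derivative p).eval x * singularGaussian t γ x) := by
    simp only [f]
    refine (integral_sub (integrable_finsetSum _ hI1) (hI2.sub hI3)).trans ?_
    refine congrArg₂ (· - ·) ?_ ((integral_sub hI2 hI3).trans ?_)
    · rw [integral_finsetSum _ hI1]
      simp only [integral_const_mul]
    · simp only [integral_const_mul]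
  linarith

/-- The moment functional of the weight. -/
noncomputable def momentFunctional (t : ι → ℝ) (hγ : ∀ j, 0 < γ j) : ℝ[X] →ₗ[ℝ] ℝ where
  toFun p := ∫ x, p.eval x * singularGaussian t γ x
  map_add' p q := by
    simp only [eval_add, add_mul]
    exact integral_add (integrable_eval_mul_singularGaussian hγ p)
      (integrable_eval_mul_singularGaussian hγ q)
  map_smul' c p := by
    simp only [eval_smul, smul_eq_mul, mul_assoc, integral_const_mul, RingHom.id_apply]

theorem integrable_cauchyKernel (hγ : ∀ j, 0 < γ j) (j : ι) {z : ℂ} (hz : z.im ≠ 0) (p : ℝ[X]) :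
    Integrable fun y : ℝ => ((p.eval y : ℝ) : ℂ) * (singularGaussian t γ y : ℂ) /
      (((y : ℂ) - (t j : ℂ)) * (z - (y : ℂ))) := by
  have h : Integrable fun y : ℝ =>
      ((p.eval y * singularGaussian t γ y / (y - t j) : ℝ) : ℂ) :=
    (integrable_eval_mul_singularGaussian_div hγ p j).ofReal
  refine (h.mul_bdd (g := fun y : ℝ => (z - (y : ℂ))⁻¹) (c := |z.im|⁻¹) ?_
    (.of_forall fun y => ?_)).congr (.of_forall fun y => ?_)
  · exact (Measurable.inv (by fun_prop)).aestronglyMeasurable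
  · rw [norm_inv]
    refine inv_anti₀ (abs_pos.2 hz) ?_
    simpa using Complex.abs_im_le_norm (z - (y : ℂ))
  · push_cast
    simp only [div_eq_mul_inv, mul_inv]
    ring

/-- The Cauchy-type transform `p ↦ ∫ p w / ((y - tⱼ) (z - y)) dy`. -/
noncomputable def cauchyFunctional (t : ι → ℝ) (hγ : ∀ j, 0 < γ j) (j : ι) {z : ℂ}
    (hz : z.im ≠ 0) : ℝ[X] →ₗ[ℝ] ℂ where
  toFun p := ∫ y : ℝ, ((p.eval y : ℝ) : ℂ) * (singularGaussian t γ y : ℂ) /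
    (((y : ℂ) - (t j : ℂ)) * (z - (y : ℂ)))
  map_add' p q := by
    simp only [eval_add, Complex.ofReal_add, add_mul, add_div]
    exact integral_add (integrable_cauchyKernel hγ j hz p) (integrable_cauchyKernel hγ j hz q)
  map_smul' c p := by
    simp only [eval_smul, smul_eq_mul, Complex.ofReal_mul, mul_assoc, mul_div_assoc,
      integral_const_mul, RingHom.id_apply, Complex.real_smul]

theorem mul_cauchyFunctional_sub (hγ : ∀ j, 0 < γ j) (j : ι) {z : ℂ} (hz : z.im ≠ 0) (p : ℝ[X]) :
    z * cauchyFunctional t hγ j hz p - cauchyFunctional t hγ j hz (X * p) =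
      ((∫ x, p.eval x * singularGaussian t γ x / (x - t j) : ℝ) : ℂ) := by
  simp only [cauchyFunctional, LinearMap.coe_mk, AddHom.coe_mk]
  rw [← integral_const_mul, ← integral_sub ((integrable_cauchyKernel hγ j hz p).const_mul z)
    (integrable_cauchyKernel hγ j hz (X * p)), ← integral_complex_ofReal]
  congr 1
  funext y
  have hzy : z - (y : ℂ) ≠ 0 := by
    intro h
    apply hz
    simpa using congrArg Complex.im h
  rw [eval_mul, eval_X]
  push_cast
  rw [mul_div_assoc', ← sub_div, ← mul_div_mul_right _ ((y : ℂ) - (t j : ℂ)) hzy]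
  congr 1
  ring

end Weight

theorem compatibility_S1
    (N : ℕ) (hN : 1 ≤ N)
    (t γ : Fin N → ℝ) (ht : Function.Injective t) (hγ : ∀ j, 0 < γ j)
    (w : ℝ → ℝ) (hw : ∀ x : ℝ, w x = Real.exp (-x ^ 2) * ∏ j, |x - t j| ^ γ j)
    (P : ℕ → Polynomial ℝ)
    (hPmonic : ∀ n, (P n).Monic) (hPdeg : ∀ n, (P n).natDegree = n)
    (horth : ∀ m n, m ≠ n → ∫ x : ℝ, (P m).eval x * (P n).eval x * w x = 0)
    (h : ℕ → ℝ) (hh : ∀ n, h n = ∫ x : ℝ, ((P n).eval x) ^ 2 * w x)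
    (hhpos : ∀ n, 0 < h n)
    (β : ℕ → ℝ) (hβ0 : β 0 = 0) (hβ : ∀ n, β (n + 1) = h (n + 1) / h n)
    (α : ℕ → ℝ) (hα : ∀ n, α n = (∫ x : ℝ, x * ((P n).eval x) ^ 2 * w x) / h n)
    (A B : ℕ → ℂ → ℂ)
    (hA : ∀ n (z : ℂ), A n z = 2 + ∑ j, ((γ j / h n : ℝ) : ℂ) *
      ∫ y : ℝ, (Complex.ofReal ((P n).eval y)) ^ 2 * (w y : ℂ) / (((y : ℂ) - (t j : ℂ)) * (z - (y : ℂ))))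
    (hB0 : ∀ z : ℂ, B 0 z = 0)
    (hB : ∀ n (z : ℂ), B (n + 1) z = ∑ j, ((γ j / h n : ℝ) : ℂ) *
      ∫ y : ℝ, (Complex.ofReal ((P (n + 1)).eval y)) * (Complex.ofReal ((P n).eval y)) * (w y : ℂ) / (((y : ℂ) - (t j : ℂ)) * (z - (y : ℂ))))
    (n : ℕ) (z : ℂ) (hz : z.im ≠ 0) :
    B (n + 1) z + B n z = (z - (α n : ℂ)) * A n z - 2 * z := by
  obtain rfl : w = singularGaussian t γ := funext hw
  set L := momentFunctional t hγ
  set J := fun j => cauchyFunctional t hγ j hz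
  have hL : ∀ p, L p = ∫ x, p.eval x * singularGaussian t γ x := fun _ => rfl
  have hh0 : ∀ k, h k ≠ 0 := fun k => (hhpos k).ne'
  have hLorth : ∀ m k, m ≠ k → L (P m * P k) = 0 := by
    intro m k hmk
    simpa only [hL, eval_mul] using horth m k hmk
  have hLnorm : ∀ k, L (P k * P k) = h k := by
    intro k
    simp only [hL, eval_mul, hh k, sq]
  have hα' : ∀ k, L (P k * (X * P k)) = α k * h k := by
    intro k
    rw [hα k, div_mul_cancel₀ _ (hh0 k), hL]
    congr 1
    funext x
    simp only [eval_mul, eval_X]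
    ring
  have hA' : A n z = 2 + ∑ j, ((γ j / h n : ℝ) : ℂ) * J j (P n * P n) := by
    rw [hA]
    simp only [J, cauchyFunctional, LinearMap.coe_mk, AddHom.coe_mk, eval_mul, Complex.ofReal_mul,
      sq]
  have hB' : ∀ k, B (k + 1) z = ∑ j, ((γ j / h k : ℝ) : ℂ) * J j (P (k + 1) * P k) := by
    intro k
    rw [hB]
    simp only [J, cauchyFunctional, LinearMap.coe_mk, AddHom.coe_mk, eval_mul, Complex.ofReal_mul]
  have hsum : B (n + 1) z + B n z =
      ∑ j, ((γ j / h n : ℝ) : ℂ) * J j ((X - C (α n)) * (P n * P n)) := by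
    cases n with
    | zero =>
      rw [hB0, hB', recurrence_zero hPmonic hPdeg hLorth hLnorm hh0 _ (hα' 0), add_zero]
      simp only [mul_assoc]
    | succ m =>
      rw [hB', hB', ← Finset.sum_add_distrib]
      refine Finset.sum_congr rfl fun j _ => ?_
      have hrec := recurrence_succ hPmonic hPdeg hLorth hLnorm hh0 m _ (hα' (m + 1))
      have hpoly : (X - C (α (m + 1))) * (P (m + 1) * P (m + 1)) =
          P (m + 1 + 1) * P (m + 1) + (h (m + 1) / h m) • (P (m + 1) * P m) := by
        rw [hrec, smul_eq_C_mul]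
        ring
      have h1 : (h (m + 1) : ℂ) ≠ 0 := by exact_mod_cast hh0 (m + 1)
      have h2 : (h m : ℂ) ≠ 0 := by exact_mod_cast hh0 m
      rw [hpoly, map_add, map_smul, Complex.real_smul]
      push_cast
      field_simp
  have hparts : ∑ j, γ j * ∫ x, (P n * P n).eval x * singularGaussian t γ x / (x - t j) =
      2 * (α n * h n) := by
    rw [integral_eval_mul_logDeriv_singularGaussian hγ, ← hL, ← hL]
    have hder : L (derivative (P n * P n)) = 0 := by
      have hlow := functional_mul_eq_coeff_mul hPmonic hPdeg hLorth hLnorm n (derivative (P n))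
        ((degree_derivative_lt (hPmonic n).ne_zero).trans (by
          rw [degree_eq_natDegree (hPmonic n).ne_zero, hPdeg]
          exact_mod_cast Nat.lt_succ_self n))
      rw [coeff_derivative, coeff_eq_zero_of_natDegree_lt (by rw [hPdeg]; omega), zero_mul,
        zero_mul] at hlow
      rw [derivative_mul, map_add, mul_comm (derivative (P n)), hlow, add_zero]
    rw [hder, sub_zero, mul_left_comm X, hα']
  have hterm : ∀ j, (z - (α n : ℂ)) * J j (P n * P n) - J j ((X - C (α n)) * (P n * P n)) =
      ((∫ x, (P n * P n).eval x * singularGaussian t γ x / (x - t j) : ℝ) : ℂ) := by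
    intro j
    rw [← mul_cauchyFunctional_sub hγ j hz, sub_mul X, ← smul_eq_C_mul, map_sub, map_smul,
      Complex.real_smul]
    ring
  have hdiff : (z - (α n : ℂ)) * (∑ j, ((γ j / h n : ℝ) : ℂ) * J j (P n * P n)) -
      ∑ j, ((γ j / h n : ℝ) : ℂ) * J j ((X - C (α n)) * (P n * P n)) = 2 * (α n : ℂ) := by
    have hn : (h n : ℂ) ≠ 0 := by exact_mod_cast hh0 n
    calc _ = ((∑ j, γ j * ∫ x, (P n * P n).eval x * singularGaussian t γ x / (x - t j) : ℝ) : ℂ) /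
          (h n : ℂ) := by
          rw [Finset.mul_sum, ← Finset.sum_sub_distrib, Complex.ofReal_sum, Finset.sum_div]
          refine Finset.sum_congr rfl fun j _ => ?_
          rw [Complex.ofReal_mul, ← hterm]
          push_cast
          ring
      _ = 2 * (α n : ℂ) := by
          rw [hparts]
          push_cast
          field_simp
  rw [hsum, hA']
  linear_combination -hdiff
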